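/- arXiv:2603.07172 — 6 statements merged into one kernel-verified Lean document; each statement's English description precedes it below -/
import Mathlib

section
/- Let k ≥ 2 be an even integer and let n ≥ 0 be an integer such that L_{-n}^{(k)} = 0. Then n < 2·k^(k²)·log(490·k²), where log denotes the natural logarithm. -/
/-- `L : ℤ → ℤ` is the `k`-generalized Lucas sequence: it satisfies the order-`k`
recurrence everywhere, with `L 0 = 2`, `L 1 = 1`, and `L n = 0` for `-(k-2) ≤ n ≤ -1`. -/
def IsGenLucas (k : ℕ) (L : ℤ → ℤ) : Prop :=
  (∀ n : ℤ, L n = ∑ i ∈ Finset.Icc 1 k, L (n - (i : ℤ))) ∧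
  L 0 = 2 ∧ L 1 = 1 ∧ ∀ n : ℤ, -((k : ℤ) - 2) ≤ n → n ≤ -1 → L n = 0

namespace IsGenLucas

variable {k : ℕ} {L : ℤ → ℤ}

lemma eq_sum_range (hL : IsGenLucas k L) (n : ℤ) :
    L n = ∑ i ∈ Finset.range k, L (n - ((i : ℤ) + 1)) := by
  have h := Finset.sum_Ico_add' (fun i : ℕ => L (n - i)) 0 k 1
  rw [zero_add, Finset.Ico_add_one_right_eq_Icc, ← Finset.range_eq_Ico] at h
  rw [hL.1 n, ← h]
  simp only [Nat.cast_add, Nat.cast_one]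

/-- Telescoping the defining recurrence gives a three-term one. -/
lemma apply_sub (hL : IsGenLucas k L) (n : ℤ) : L (n - k) = 2 * L n - L (n + 1) := by
  have h₁ := hL.eq_sum_range n
  have h₂ := hL.eq_sum_range (n + 1)
  have h₃ := Finset.sum_range_succ (fun i : ℕ => L (n - i)) k
  rw [Finset.sum_range_succ'] at h₃
  simp only [add_sub_add_right_eq_sub, Nat.cast_add, Nat.cast_one, Nat.cast_zero, sub_zero]
    at h₁ h₂ h₃
  linarith

lemma apply_one_sub (hL : IsGenLucas k L) (hk : 2 ≤ k) : L (1 - k) = -1 := by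
  obtain ⟨m, rfl⟩ := Nat.exists_eq_add_of_le' hk
  have h := hL.eq_sum_range 1
  have hzero : ∑ i ∈ Finset.range m, L (1 - (((i + 1 : ℕ) : ℤ) + 1)) = 0 := by
    refine Finset.sum_eq_zero fun i hi => hL.2.2.2 _ ?_ ?_
    · have := Finset.mem_range.1 hi
      push_cast
      omega
    · push_cast
      omega
  rw [Finset.sum_range_succ, Finset.sum_range_succ', hzero] at h
  have e : (1 : ℤ) - (((m + 1 : ℕ) : ℤ) + 1) = 1 - ((m + 2 : ℕ) : ℤ) := by push_cast; ring
  rw [e] at h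
  simp only [Nat.cast_zero, zero_add, sub_self, hL.2.1, hL.2.2.1] at h
  linarith

lemma signed_rec (hL : IsGenLucas k L) (hke : Even k) (j : ℕ) :
    (-1) ^ (j + 1 + k) * L (-((j + 1 + k : ℕ) : ℤ)) =
      2 * ((-1) ^ (j + 1) * L (-((j + 1 : ℕ) : ℤ))) + (-1) ^ j * L (-(j : ℤ)) := by
  have h := hL.apply_sub (-((j + 1 : ℕ) : ℤ))
  have e₁ : -((j + 1 : ℕ) : ℤ) - k = -((j + 1 + k : ℕ) : ℤ) := by push_cast; ring
  have e₂ : -((j + 1 : ℕ) : ℤ) + 1 = -(j : ℤ) := by push_cast; ring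
  rw [e₁, e₂] at h
  rw [h, pow_add _ (j + 1) k, hke.neg_one_pow]
  ring

lemma apply_neg_self (hL : IsGenLucas k L) : L (-(k : ℤ)) = 3 := by
  have h := hL.apply_sub 0
  simp only [zero_sub, zero_add, hL.2.1, hL.2.2.1] at h
  linarith

lemma signed_nonneg (hL : IsGenLucas k L) (hk : 2 ≤ k) (hke : Even k) (j : ℕ) :
    0 ≤ (-1) ^ j * L (-(j : ℤ)) := by
  induction j using Nat.strong_induction_on with
  | _ j ih =>
    rcases lt_or_ge k j with hj | hj
    · obtain ⟨i, rfl⟩ : ∃ i, j = i + 1 + k := ⟨j - k - 1, by omega⟩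
      rw [hL.signed_rec hke]
      have := ih (i + 1) (by omega)
      have := ih i (by omega)
      positivity
    · rcases eq_or_lt_of_le hj with rfl | hj
      · rw [hL.apply_neg_self, hke.neg_one_pow]
        norm_num
      · rcases Nat.eq_zero_or_pos j with rfl | hpos
        · simp [hL.2.1]
        · rcases eq_or_lt_of_le (Nat.succ_le_of_lt hj) with h | h
          · have e : -(j : ℤ) = 1 - k := by omega
            have hodd : Odd j := by
              rw [← h] at hke
              exact Nat.not_even_iff_odd.1 (Nat.even_add_one.1 hke)
            rw [e, hL.apply_one_sub hk, hodd.neg_one_pow]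
            norm_num
          · rw [hL.2.2.2 (-(j : ℤ)) (by omega) (by omega), mul_zero]

lemma signed_pos_add_self (hL : IsGenLucas k L) (hk : 2 ≤ k) (hke : Even k) {j : ℕ}
    (hj : 0 < (-1) ^ j * L (-(j : ℤ))) : 0 < (-1) ^ (j + k) * L (-((j + k : ℕ) : ℤ)) := by
  rcases j with _ | i
  · simp [hL.apply_neg_self, hke.neg_one_pow]
  · rw [hL.signed_rec hke]
    have := hL.signed_nonneg hk hke i
    linarith

lemma signed_pos_add_self_add_one (hL : IsGenLucas k L) (hk : 2 ≤ k) (hke : Even k) {j : ℕ}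
    (hj : 0 < (-1) ^ j * L (-(j : ℤ))) :
    0 < (-1) ^ (j + (k + 1)) * L (-((j + (k + 1) : ℕ) : ℤ)) := by
  rw [show j + (k + 1) = j + 1 + k by ring, hL.signed_rec hke]
  have := hL.signed_nonneg hk hke (j + 1)
  linarith

lemma signed_pos_of_combination (hL : IsGenLucas k L) (hk : 2 ≤ k) (hke : Even k) (a b : ℕ) :
    0 < (-1) ^ (a * k + b * (k + 1)) * L (-((a * k + b * (k + 1) : ℕ) : ℤ)) := by
  induction b with
  | zero =>
    induction a with
    | zero => simp [hL.2.1]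
    | succ a ih =>
      have := hL.signed_pos_add_self hk hke ih
      rwa [show a * k + 0 * (k + 1) + k = (a + 1) * k + 0 * (k + 1) by ring] at this
  | succ b ih =>
    have := hL.signed_pos_add_self_add_one hk hke ih
    rwa [show a * k + b * (k + 1) + (k + 1) = a * k + (b + 1) * (k + 1) by ring] at this

/-- Every `n ≥ k ^ 2` is a combination of `k` and `k + 1`, so zeros at negative indices
occur only above `-k ^ 2`. -/
lemma lt_sq_of_apply_neg_eq_zero (hL : IsGenLucas k L) (hk : 2 ≤ k) (hke : Even k) {n : ℕ}
    (hn : L (-(n : ℤ)) = 0) : n < k ^ 2 := by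
  by_contra! h
  have hq : k ≤ n / k := (Nat.le_div_iff_mul_le (by omega)).2 (by rwa [← sq])
  have hr : n % k < k := Nat.mod_lt _ (by omega)
  obtain ⟨a, ha⟩ := Nat.exists_eq_add_of_le (hr.le.trans hq)
  have e : a * k + n % k * (k + 1) = n := by
    conv_rhs => rw [← Nat.div_add_mod n k, ha]
    ring
  have := hL.signed_pos_of_combination hk hke a (n % k)
  rw [e, hn, mul_zero] at this
  exact this.false

end IsGenLucas

theorem skolem_bound_even (k : ℕ) (hk : 2 ≤ k) (hke : Even k)
    (L : ℤ → ℤ) (hL : IsGenLucas k L) (n : ℕ) (hn : L (-(n : ℤ)) = 0) :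
    (n : ℝ) < 2 * (k : ℝ) ^ (k ^ 2) * Real.log (490 * (k : ℝ) ^ 2) := by
  have hlt : n < k ^ (k ^ 2) :=
    (hL.lt_sq_of_apply_neg_eq_zero hk hke hn).trans (Nat.lt_pow_self (by omega))
  have hlt' : (n : ℝ) < (k : ℝ) ^ (k ^ 2) := by exact_mod_cast hlt
  have hk' : (2 : ℝ) ≤ k := by exact_mod_cast hk
  have hlog : 1 ≤ Real.log (490 * (k : ℝ) ^ 2) := by
    rw [Real.le_log_iff_exp_le (by positivity)]
    nlinarith [Real.exp_one_lt_d9]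
  nlinarith [Nat.cast_nonneg (α := ℝ) n]
end

section
/- Let k ≥ 2 and let m, r be integers with 0 ≤ m < r ≤ k-2. Then L_{-(mk+r)}^{(k)} = 0. -/
/-- Subtracting two consecutive instances of the recurrence. -/
theorem IsGenLucas.sub_order {k : ℕ} {L : ℤ → ℤ} (hL : IsGenLucas k L) (n : ℤ) :
    L (n - k) = 2 * L n - L (n + 1) := by
  have rec_range (n : ℤ) : L n = ∑ i ∈ Finset.range k, L (n - ((i + 1 : ℕ) : ℤ)) := by
    rw [hL.1 n, Finset.range_eq_Ico,
      Finset.sum_Ico_add' (fun i : ℕ ↦ L (n - (i : ℤ))) 0 k 1]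
    rfl
  have hsucc : L (n + 1) = ∑ i ∈ Finset.range k, L (n - (i : ℤ)) := by
    rw [rec_range]
    refine Finset.sum_congr rfl fun i _ ↦ congrArg L ?_
    push_cast
    ring
  have h := Finset.sum_range_succ (fun i : ℕ ↦ L (n - (i : ℤ))) k
  rw [Finset.sum_range_succ', ← rec_range, ← hsucc, Nat.cast_zero, sub_zero] at h
  linarith

/-- The initial block of zeros, by induction on the multiple of `k`. -/
theorem IsGenLucas.eq_zero_of_lt {k : ℕ} {L : ℤ → ℤ} (hL : IsGenLucas k L) (m : ℕ) :
    ∀ r : ℤ, (m : ℤ) < r → r ≤ (k : ℤ) - 2 → L (-(m * k + r)) = 0 := by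
  induction m with
  | zero =>
    intro r hmr hr
    apply hL.2.2.2 <;> push_cast at * <;> linarith
  | succ m ih =>
    intro r hmr hr
    push_cast at hmr
    have hstep := hL.sub_order (-(m * k + r))
    rw [show -(m * k + r) + 1 = -(m * k + (r - 1)) by ring,
      ih r (by linarith) hr, ih (r - 1) (by linarith) (by linarith)] at hstep
    rw [show -(((m + 1 : ℕ) : ℤ) * k + r) = -(m * k + r) - k by push_cast; ring, hstep]
    norm_num

theorem zeros_initial_block (k : ℕ) (hk : 2 ≤ k) (L : ℤ → ℤ) (hL : IsGenLucas k L)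
    (m r : ℤ) (hm : 0 ≤ m) (hmr : m < r) (hr : r ≤ (k : ℤ) - 2) :
    L (-(m * k + r)) = 0 := by
  lift m to ℕ using hm
  exact hL.eq_zero_of_lt m r hmr hr
end

section
/- Let k ≥ 3 and let m, r be integers with 1 ≤ m ≤ k-2 and 0 ≤ r ≤ m. Then, as rational numbers, L_{-(mk+r)}^{(k)} = (-1)^r · ( ψ(m-1, r-1)·2^(m-r) + ψ(m-1, r)·2^(m-r-2) ). -/
/-- Extended binomial coefficient: `C a b = a.choose b` when `0 ≤ b ≤ a`, and `0` otherwise. -/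
def C (a b : ℤ) : ℤ := if 0 ≤ b ∧ b ≤ a then (a.toNat).choose b.toNat else 0

/-- `ψ(y, z) = C(y, z) + C(y+1, z+1)`. -/
def psi (y z : ℤ) : ℤ := C y z + C (y + 1) (z + 1)

theorem C_pascal {a : ℤ} (ha : 0 ≤ a) (b : ℤ) : C (a + 1) b = C a b + C a (b - 1) := by
  obtain ⟨n, rfl⟩ := Int.eq_ofNat_of_zero_le ha
  rcases lt_or_ge b 0 with hb | hb
  · simp [C, show ¬ 0 ≤ b by omega, show ¬ 1 ≤ b by omega]
  obtain ⟨c, rfl⟩ := Int.eq_ofNat_of_zero_le hb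
  have hC : ∀ p q : ℕ, C p q = (p.choose q : ℤ) := by
    intro p q
    unfold C
    split_ifs with h
    · simp
    · rw [Nat.choose_eq_zero_of_lt (by omega), Nat.cast_zero]
  cases c with
  | zero =>
    simp [C, show (0 : ℤ) ≤ (n : ℤ) + 1 by omega]
  | succ c =>
    have h := hC (n + 1) (c + 1)
    have h' := hC n (c + 1)
    have h'' := hC n c
    rw [Nat.choose_succ_succ] at h
    push_cast at *
    rw [h, h', add_sub_cancel_right, h'']
    ring

theorem C_eq_zero_of_lt {a b : ℤ} (h : a < b) : C a b = 0 :=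
  if_neg (by omega)

theorem C_eq_zero_of_neg {a b : ℤ} (h : b < 0) : C a b = 0 :=
  if_neg (by omega)

theorem psi_pascal {y : ℤ} (hy : 0 ≤ y) (z : ℤ) : psi (y + 1) z = psi y z + psi y (z - 1) := by
  unfold psi
  rw [C_pascal hy z, C_pascal (show 0 ≤ y + 1 by omega) (z + 1), add_sub_cancel_right,
    sub_add_cancel]
  ring

theorem psi_eq_zero_of_lt {y z : ℤ} (h : y < z) : psi y z = 0 := by
  rw [psi, C_eq_zero_of_lt h, C_eq_zero_of_lt (by omega), add_zero]

theorem psi_eq_zero_of_lt_neg_one {y z : ℤ} (h : z < -1) : psi y z = 0 := by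
  rw [psi, C_eq_zero_of_neg (by omega), C_eq_zero_of_neg (by omega), add_zero]

/-- The closed form for `L (-(m * k + r))` in the triangular region. -/
def triangularValue (m r : ℤ) : ℚ :=
  (-1 : ℚ) ^ r *
    ((psi (m - 1) (r - 1) : ℚ) * (2 : ℚ) ^ (m - r) +
      (psi (m - 1) r : ℚ) * (2 : ℚ) ^ (m - r - 2))

theorem triangularValue_succ {m : ℤ} (hm : 1 ≤ m) (r : ℤ) :
    triangularValue (m + 1) r = 2 * triangularValue m r - triangularValue m (r - 1) := by
  have h₁ := psi_pascal (show 0 ≤ m - 1 by omega) r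
  have h₂ := psi_pascal (show 0 ≤ m - 1 by omega) (r - 1)
  have e₁ : (2 : ℚ) ^ (m + 1 - r) = 8 * 2 ^ (m - r - 2) := by
    rw [show m + 1 - r = (m - r - 2) + 3 by ring, zpow_add₀ two_ne_zero]; norm_num; ring
  have e₂ : (2 : ℚ) ^ (m + 1 - r - 2) = 2 * 2 ^ (m - r - 2) := by
    rw [show m + 1 - r - 2 = (m - r - 2) + 1 by ring, zpow_add₀ two_ne_zero]; norm_num; ring
  have e₃ : (2 : ℚ) ^ (m - r) = 4 * 2 ^ (m - r - 2) := by
    rw [show m - r = (m - r - 2) + 2 by ring, zpow_add₀ two_ne_zero]; norm_num; ring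
  have e₄ : (-1 : ℚ) ^ (r - 1) = -(-1) ^ r := by
    rw [zpow_sub_one₀ (by norm_num)]; norm_num
  unfold triangularValue
  rw [show m - (r - 1) = m + 1 - r by ring, e₂, e₁, e₃, e₄,
    show m + 1 - 1 = m - 1 + 1 by ring, h₁, h₂]
  push_cast
  ring

theorem triangularValue_eq_zero_of_lt {m r : ℤ} (h : m < r) : triangularValue m r = 0 := by
  simp [triangularValue, psi_eq_zero_of_lt (show m - 1 < r - 1 by omega),
    psi_eq_zero_of_lt (show m - 1 < r by omega)]

theorem triangularValue_eq_zero_of_lt_neg_one {m r : ℤ} (h : r < -1) :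
    triangularValue m r = 0 := by
  simp [triangularValue, psi_eq_zero_of_lt_neg_one (show r - 1 < -1 by omega),
    psi_eq_zero_of_lt_neg_one h]

theorem sum_Icc_sub_sum_Icc_shift (f : ℕ → ℤ) (k : ℕ) :
    ∑ i ∈ Finset.Icc 1 k, f i - ∑ i ∈ Finset.Icc 1 k, f (i + 1) = f 1 - f (k + 1) := by
  induction k with
  | zero => simp
  | succ k ih =>
    rw [Finset.sum_Icc_succ_top (by omega), Finset.sum_Icc_succ_top (by omega)]
    linarith

namespace IsGenLucas

variable {k : ℕ} {L : ℤ → ℤ}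

theorem neg_add (hL : IsGenLucas k L) (j : ℤ) :
    L (-(k + j)) = 2 * L (-j) - L (-(j - 1)) := by
  have h := sum_Icc_sub_sum_Icc_shift (fun i => L (-(j - 1) - (i : ℤ))) k
  have h₁ := hL.1 (-(j - 1))
  have h₂ : L (-j) = ∑ i ∈ Finset.Icc 1 k, L (-(j - 1) - ((i + 1 : ℕ) : ℤ)) := by
    rw [hL.1 (-j)]
    refine Finset.sum_congr rfl fun i _ => congrArg L ?_
    push_cast
    ring
  simp only [← h₁, ← h₂] at h
  rw [show -(j - 1) - ((1 : ℕ) : ℤ) = -j by push_cast; ring,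
    show -(j - 1) - ((k + 1 : ℕ) : ℤ) = -(k + j) by push_cast; ring] at h
  linarith

theorem neg_sub_one (hL : IsGenLucas k L) (hk : 2 ≤ k) : L (-((k : ℤ) - 1)) = -1 := by
  obtain ⟨n, rfl⟩ := Nat.exists_eq_add_of_le' hk
  have h := hL.1 1
  rw [Finset.sum_Icc_succ_top (by omega),
    Finset.sum_eq_single_of_mem 1 (by simp)] at h
  · have e : (1 : ℤ) - ((n + 1 + 1 : ℕ) : ℤ) = -(((n + 2 : ℕ) : ℤ) - 1) := by push_cast; ring
    rw [e, hL.2.2.1, Nat.cast_one, sub_self, hL.2.1] at h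
    linarith
  · intro i hi hi'
    rw [Finset.mem_Icc] at hi
    exact hL.2.2.2 _ (by push_cast; omega) (by omega)

theorem eq_triangularValue_one (hL : IsGenLucas k L) (hk : 3 ≤ k) {r : ℤ} (h₁ : -2 ≤ r)
    (h₂ : r ≤ (k : ℤ) - 2) : (L (-(k + r)) : ℚ) = triangularValue 1 r := by
  obtain ⟨-, h0, h1, hz⟩ := id hL
  rcases lt_or_ge 1 r with hr | hr
  · rw [triangularValue_eq_zero_of_lt hr, hL.neg_add, hz _ (by omega) (by omega),
      hz _ (by omega) (by omega)]
    norm_num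
  interval_cases r
  · rw [triangularValue_eq_zero_of_lt_neg_one (by norm_num), hz _ (by omega) (by omega)]
    norm_num
  · rw [← sub_eq_add_neg, hL.neg_sub_one (by omega)]
    norm_num [triangularValue, psi, C]
  · rw [hL.neg_add]
    norm_num [triangularValue, psi, C, h0, h1]
  · rw [hL.neg_add, hz (-1) (by omega) (by omega)]
    norm_num [triangularValue, psi, C, h0]

theorem eq_triangularValue (hL : IsGenLucas k L) (hk : 3 ≤ k) {m : ℤ} (hm : 1 ≤ m) :
    m ≤ (k : ℤ) - 2 → ∀ r : ℤ, -2 ≤ r → r ≤ (k : ℤ) - 2 →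
      (L (-(m * k + r)) : ℚ) = triangularValue m r := by
  induction m, hm using Int.leInduction with
  | base =>
    intro _ r h₁ h₂
    rw [one_mul, hL.eq_triangularValue_one hk h₁ h₂]
  | succ m hm ih =>
    intro hmk r h₁ h₂
    rcases h₁.eq_or_lt with rfl | h₁
    · rw [triangularValue_eq_zero_of_lt_neg_one (by norm_num),
        show (m + 1) * (k : ℤ) + -2 = m * k + (k - 2) by ring,
        ih (by omega) _ (by omega) le_rfl, triangularValue_eq_zero_of_lt (by omega)]
    · rw [triangularValue_succ hm, ← ih (by omega) r (by omega) h₂,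
        ← ih (by omega) (r - 1) (by omega) (by omega),
        show (m + 1) * (k : ℤ) + r = k + (m * k + r) by ring, hL.neg_add, add_sub_assoc]
      push_cast
      rfl

end IsGenLucas

theorem value_triangular_region (k : ℕ) (hk : 3 ≤ k) (L : ℤ → ℤ) (hL : IsGenLucas k L)
    (m r : ℤ) (hm1 : 1 ≤ m) (hm2 : m ≤ (k : ℤ) - 2) (hr1 : 0 ≤ r) (hr2 : r ≤ m) :
    (L (-(m * k + r)) : ℚ) =
      (-1 : ℚ) ^ r *
        ((psi (m - 1) (r - 1) : ℚ) * (2 : ℚ) ^ (m - r) +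
          (psi (m - 1) r : ℚ) * (2 : ℚ) ^ (m - r - 2)) := by
  exact hL.eq_triangularValue hk hm1 hm2 r (by omega) (by omega)
end

section
/- Let k = 2 and let m ≥ 1 be an integer. Then, as rational numbers, L_{-(2m-1)}^{(2)} = - Σ_{i=0}^{m-1} ( ψ(m-i-1, 2i-2)·2^(m-3i+1) + ψ(m-i-1, 2i-1)·2^(m-3i-1) ) and L_{-2m}^{(2)} = Σ_{i=0}^{m-1} ( ψ(m-i-1, 2i-1)·2^(m-3i) + ψ(m-i-1, 2i)·2^(m-3i-2) ). -/
theorem C_eq_zero {a b : ℤ} (h : b < 0 ∨ a < b) : C a b = 0 :=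
  if_neg (by omega)

theorem C_succ_succ {a b : ℤ} (h : 0 ≤ a ∨ 0 ≤ b) : C (a + 1) (b + 1) = C a b + C a (b + 1) := by
  rcases lt_or_ge b 0 with hb | hb
  · rcases eq_or_lt_of_le (show b ≤ -1 by omega) with rfl | hb'
    · have ha : 0 ≤ a := by omega
      simp [C, ha, show 0 ≤ a + 1 by omega]
    · simp [C_eq_zero, hb, show b + 1 < 0 by omega]
  · rcases lt_or_ge a b with hab | hab
    · rw [C_eq_zero (by omega), C_eq_zero (by omega), C_eq_zero (by omega), add_zero]
    · lift b to ℕ using hb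
      lift a to ℕ using by omega
      rcases eq_or_lt_of_le hab with h | h
      · obtain rfl : b = a := by omega
        rw [C_eq_zero (a := b) (b := b + 1) (by omega)]
        unfold C
        rw [if_pos (by omega), if_pos (by omega)]
        norm_cast
        simp
      · unfold C
        rw [if_pos (by omega), if_pos (by omega), if_pos (by omega)]
        norm_cast

/-- The weighted binomial term `C(n-i, 2i) 2^(n-3i)`. -/
def evenTerm (n i : ℤ) : ℚ := C (n - i) (2 * i) * 2 ^ (n - 3 * i)

/-- The weighted binomial term `C(n-i, 2i+1) 2^(n-1-3i)`. -/
def oddTerm (n i : ℤ) : ℚ := C (n - i) (2 * i + 1) * 2 ^ (n - 1 - 3 * i)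

def evenSum (n : ℕ) : ℚ := ∑ i ∈ Finset.range (n + 1), evenTerm n i

def oddSum (n : ℕ) : ℚ := ∑ i ∈ Finset.range (n + 1), oddTerm n i

theorem evenTerm_eq_zero {n i : ℤ} (h : n < 3 * i) : evenTerm n i = 0 := by
  simp [evenTerm, C_eq_zero (a := n - i) (b := 2 * i) (by omega)]

theorem oddTerm_eq_zero {n i : ℤ} (h : n < 3 * i + 1) : oddTerm n i = 0 := by
  simp [oddTerm, C_eq_zero (a := n - i) (b := 2 * i + 1) (by omega)]

theorem oddTerm_neg_one (n : ℤ) : oddTerm n (-1) = 0 := by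
  simp [oddTerm, C_eq_zero]

theorem evenTerm_neg_one (n : ℤ) : evenTerm n (-1) = 0 := by
  simp [evenTerm, C_eq_zero]

theorem sum_range_eq_of_vanishing {f : ℤ → ℚ} {M N : ℕ} (hM : ∀ i : ℤ, M ≤ i → f i = 0)
    (hN : ∀ i : ℤ, N ≤ i → f i = 0) :
    ∑ i ∈ Finset.range M, f i = ∑ i ∈ Finset.range N, f i := by
  rcases le_total M N with h | h
  · refine Finset.sum_subset (by simpa using h) fun i _ hi ↦ hM _ ?_
    simpa using hi
  · refine (Finset.sum_subset (by simpa using h) fun i _ hi ↦ hN _ ?_).symm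
    simpa using hi

theorem sum_evenTerm {n N : ℕ} (h : n < 3 * N) :
    ∑ i ∈ Finset.range N, evenTerm n i = evenSum n :=
  sum_range_eq_of_vanishing (fun _ _ ↦ evenTerm_eq_zero (by omega))
    fun _ _ ↦ evenTerm_eq_zero (by push_cast at *; omega)

theorem sum_oddTerm {n N : ℕ} (h : n < 3 * N + 1) :
    ∑ i ∈ Finset.range N, oddTerm n i = oddSum n :=
  sum_range_eq_of_vanishing (fun _ _ ↦ oddTerm_eq_zero (by omega))
    fun _ _ ↦ oddTerm_eq_zero (by push_cast at *; omega)

theorem sum_evenTerm_sub_one {n N : ℕ} (h : n < 3 * N) :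
    ∑ i ∈ Finset.range (N + 1), evenTerm n ((i : ℤ) - 1) = evenSum n := by
  simp [Finset.sum_range_succ', evenTerm_neg_one, sum_evenTerm h]

theorem sum_oddTerm_sub_one {n N : ℕ} (h : n < 3 * N + 1) :
    ∑ i ∈ Finset.range (N + 1), oddTerm n ((i : ℤ) - 1) = oddSum n := by
  simp [Finset.sum_range_succ', oddTerm_neg_one, sum_oddTerm h]

theorem evenTerm_add_two {n i : ℤ} (hn : 0 ≤ n) (hi : 0 ≤ i) :
    evenTerm (n + 2) i = 2 * evenTerm (n + 1) i + oddTerm n (i - 1) := by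
  have h := C_succ_succ (a := n + 1 - i) (b := 2 * i - 1) (by omega)
  rw [show n + 1 - i + 1 = n + 2 - i by ring, show 2 * i - 1 + 1 = 2 * i by ring] at h
  rw [evenTerm, evenTerm, oddTerm, h, show n - (i - 1) = n + 1 - i by ring,
    show 2 * (i - 1) + 1 = 2 * i - 1 by ring, show n - 1 - 3 * (i - 1) = n + 2 - 3 * i by ring,
    show n + 2 - 3 * i = n + 1 - 3 * i + 1 by ring, zpow_add_one₀ two_ne_zero]
  push_cast
  ring

theorem oddTerm_add_one (n : ℤ) {i : ℤ} (hi : 0 ≤ i) :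
    oddTerm (n + 1) i = 2 * oddTerm n i + evenTerm n i := by
  have h := C_succ_succ (a := n - i) (b := 2 * i) (by omega)
  rw [show n - i + 1 = n + 1 - i by ring] at h
  rw [evenTerm, oddTerm, oddTerm, h, show n + 1 - 1 - 3 * i = n - 1 - 3 * i + 1 by ring,
    show n - 3 * i = n - 1 - 3 * i + 1 by ring, zpow_add_one₀ two_ne_zero]
  push_cast
  ring

theorem evenSum_add_two (n : ℕ) : evenSum (n + 2) = 2 * evenSum (n + 1) + oddSum n := by
  rw [← sum_evenTerm (n := n + 2) (N := n + 2) (by omega),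
    ← sum_evenTerm (n := n + 1) (N := n + 2) (by omega),
    ← sum_oddTerm_sub_one (n := n) (N := n + 1) (by omega), Finset.mul_sum,
    ← Finset.sum_add_distrib]
  refine Finset.sum_congr rfl fun i _ ↦ ?_
  push_cast
  exact evenTerm_add_two (by omega) (by omega)

theorem oddSum_add_one (n : ℕ) : oddSum (n + 1) = 2 * oddSum n + evenSum n := by
  rw [← sum_oddTerm (n := n + 1) (N := n + 1) (by omega), oddSum, evenSum, Finset.mul_sum,
    ← Finset.sum_add_distrib]
  refine Finset.sum_congr rfl fun i _ ↦ ?_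
  push_cast
  exact oddTerm_add_one _ (by omega)

theorem sum_Icc_zero_eq_sum_range (f : ℤ → ℚ) (n : ℕ) :
    ∑ i ∈ Finset.Icc (0 : ℤ) n, f i = ∑ i ∈ Finset.range (n + 1), f i := by
  refine (Finset.sum_bij (fun (i : ℕ) _ ↦ (i : ℤ)) ?_ ?_ ?_ ?_).symm
  · intro i hi
    simp at hi ⊢
    omega
  · intro i _ j _ h
    exact_mod_cast h
  · intro b hb
    simp at hb
    exact ⟨b.toNat, by simp; omega, by simp; omega⟩
  · simp

theorem psi_term_odd (n i : ℤ) :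
    (psi (n + 2 - i - 1) (2 * i - 2) : ℚ) * (2 : ℚ) ^ (n + 2 - 3 * i + 1) +
        (psi (n + 2 - i - 1) (2 * i - 1) : ℚ) * (2 : ℚ) ^ (n + 2 - 3 * i - 1) =
      evenTerm n (i - 1) + oddTerm (n + 1) (i - 1) +
        (oddTerm n (i - 1) + evenTerm (n + 2) i) / 2 := by
  simp only [psi, evenTerm, oddTerm]
  rw [show n + 2 - i - 1 + 1 = n + 2 - i by ring, show n + 2 - i - 1 = n + 1 - i by ring,
    show n - (i - 1) = n + 1 - i by ring, show n + 1 - (i - 1) = n + 2 - i by ring,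
    show 2 * (i - 1) + 1 = 2 * i - 1 by ring, show 2 * (i - 1) = 2 * i - 2 by ring,
    show 2 * i - 2 + 1 = 2 * i - 1 by ring, show 2 * i - 1 + 1 = 2 * i by ring,
    show n - 3 * (i - 1) = n + 1 - 3 * i + 1 + 1 by ring,
    show n + 1 - 1 - 3 * (i - 1) = n + 1 - 3 * i + 1 + 1 by ring,
    show n - 1 - 3 * (i - 1) = n + 1 - 3 * i + 1 by ring,
    show n + 2 - 3 * i - 1 = n + 1 - 3 * i by ring,
    show n + 2 - 3 * i = n + 1 - 3 * i + 1 by ring]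
  simp only [zpow_add_one₀ (two_ne_zero : (2 : ℚ) ≠ 0) (n + 1 - 3 * i + 1),
    zpow_add_one₀ (two_ne_zero : (2 : ℚ) ≠ 0) (n + 1 - 3 * i)]
  push_cast
  ring

theorem psi_term_even (n i : ℤ) :
    (psi (n + 2 - i - 1) (2 * i - 1) : ℚ) * (2 : ℚ) ^ (n + 2 - 3 * i) +
        (psi (n + 2 - i - 1) (2 * i) : ℚ) * (2 : ℚ) ^ (n + 2 - 3 * i - 2) =
      oddTerm n (i - 1) + evenTerm (n + 2) i + (evenTerm (n + 1) i + oddTerm (n + 2) i) / 2 := by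
  simp only [psi, evenTerm, oddTerm]
  rw [show n + 2 - i - 1 + 1 = n + 2 - i by ring, show n + 2 - i - 1 = n + 1 - i by ring,
    show n - (i - 1) = n + 1 - i by ring,
    show 2 * (i - 1) + 1 = 2 * i - 1 by ring, show 2 * i - 1 + 1 = 2 * i by ring,
    show n - 1 - 3 * (i - 1) = n - 3 * i + 1 + 1 by ring,
    show n + 2 - 1 - 3 * i = n - 3 * i + 1 by ring,
    show n + 2 - 3 * i - 2 = n - 3 * i by ring,
    show n + 2 - 3 * i = n - 3 * i + 1 + 1 by ring,
    show n + 1 - 3 * i = n - 3 * i + 1 by ring]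
  simp only [zpow_add_one₀ (two_ne_zero : (2 : ℚ) ≠ 0) (n - 3 * i + 1),
    zpow_add_one₀ (two_ne_zero : (2 : ℚ) ≠ 0) (n - 3 * i)]
  push_cast
  ring

theorem sum_psi_odd (n : ℕ) :
    ∑ i ∈ Finset.Icc (0 : ℤ) ((n : ℤ) + 2 - 1),
        ((psi ((n : ℤ) + 2 - i - 1) (2 * i - 2) : ℚ) * (2 : ℚ) ^ ((n : ℤ) + 2 - 3 * i + 1) +
          (psi ((n : ℤ) + 2 - i - 1) (2 * i - 1) : ℚ) * (2 : ℚ) ^ ((n : ℤ) + 2 - 3 * i - 1)) =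
      2 * evenSum n + 3 * oddSum n + evenSum (n + 1) := by
  have h0 := sum_evenTerm_sub_one (n := n) (N := n + 1) (by omega)
  have h1 := sum_oddTerm_sub_one (n := n + 1) (N := n + 1) (by omega)
  have h2 := sum_oddTerm_sub_one (n := n) (N := n + 1) (by omega)
  have h3 := sum_evenTerm (n := n + 2) (N := n + 1 + 1) (by omega)
  push_cast at h1 h3
  simp only [psi_term_odd]
  rw [show (n : ℤ) + 2 - 1 = ((n + 1 : ℕ) : ℤ) by push_cast; ring, sum_Icc_zero_eq_sum_range]
  rw [Finset.sum_add_distrib, Finset.sum_add_distrib, ← Finset.sum_div, Finset.sum_add_distrib,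
    h0, h1, h2, h3, evenSum_add_two, oddSum_add_one]
  ring

theorem sum_psi_even (n : ℕ) :
    ∑ i ∈ Finset.Icc (0 : ℤ) ((n : ℤ) + 2 - 1),
        ((psi ((n : ℤ) + 2 - i - 1) (2 * i - 1) : ℚ) * (2 : ℚ) ^ ((n : ℤ) + 2 - 3 * i) +
          (psi ((n : ℤ) + 2 - i - 1) (2 * i) : ℚ) * (2 : ℚ) ^ ((n : ℤ) + 2 - 3 * i - 2)) =
      4 * oddSum n + evenSum n + 3 * evenSum (n + 1) := by
  have h0 := sum_oddTerm_sub_one (n := n) (N := n + 1) (by omega)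
  have h1 := sum_evenTerm (n := n + 2) (N := n + 1 + 1) (by omega)
  have h2 := sum_evenTerm (n := n + 1) (N := n + 1 + 1) (by omega)
  have h3 := sum_oddTerm (n := n + 2) (N := n + 1 + 1) (by omega)
  push_cast at h1 h2 h3
  simp only [psi_term_even]
  rw [show (n : ℤ) + 2 - 1 = ((n + 1 : ℕ) : ℤ) by push_cast; ring, sum_Icc_zero_eq_sum_range]
  rw [Finset.sum_add_distrib, Finset.sum_add_distrib, ← Finset.sum_div, Finset.sum_add_distrib,
    h0, h1, h2, h3, evenSum_add_two, oddSum_add_one, oddSum_add_one]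
  ring

theorem IsGenLucas.two_rec {L : ℤ → ℤ} (hL : IsGenLucas 2 L) (n : ℤ) :
    L n = L (n - 1) + L (n - 2) := by
  simpa [Finset.sum_Icc_succ_top] using hL.1 n

theorem IsGenLucas.two_neg_one {L : ℤ → ℤ} (hL : IsGenLucas 2 L) : L (-1) = -1 := by
  have h := hL.two_rec 1
  norm_num [hL.2.1, hL.2.2.1] at h
  omega

theorem IsGenLucas.two_neg_two {L : ℤ → ℤ} (hL : IsGenLucas 2 L) : L (-2) = 3 := by
  have h := hL.two_rec 0
  norm_num [hL.2.1, hL.two_neg_one] at h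
  omega

theorem IsGenLucas.two_neg_eq_sums {L : ℤ → ℤ} (hL : IsGenLucas 2 L) (n : ℕ) :
    (L (-(2 * ((n : ℤ) + 2) - 1)) : ℚ) = -(2 * evenSum n + 3 * oddSum n + evenSum (n + 1)) ∧
      (L (-(2 * ((n : ℤ) + 2))) : ℚ) = 4 * oddSum n + evenSum n + 3 * evenSum (n + 1) := by
  induction n with
  | zero =>
    have h3 := hL.two_rec (-1)
    have h4 := hL.two_rec (-2)
    norm_num [hL.two_neg_one, hL.two_neg_two] at h3 h4
    have e3 : L (-3) = -4 := by omega
    have e4 : L (-4) = 7 := by omega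
    norm_num [e3, e4, evenSum, oddSum, evenTerm, oddTerm, C, Finset.sum_range_succ]
  | succ n ih =>
    have h1 := hL.two_rec (-(2 * ((n : ℤ) + 2) - 1))
    have h2 := hL.two_rec (-(2 * ((n : ℤ) + 2)))
    rw [show -(2 * ((n : ℤ) + 2) - 1) - 1 = -(2 * ((n : ℤ) + 2)) by ring,
      show -(2 * ((n : ℤ) + 2) - 1) - 2 = -(2 * (((n + 1 : ℕ) : ℤ) + 2) - 1) by push_cast; ring]
      at h1
    rw [show -(2 * ((n : ℤ) + 2)) - 1 = -(2 * (((n + 1 : ℕ) : ℤ) + 2) - 1) by push_cast; ring,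
      show -(2 * ((n : ℤ) + 2)) - 2 = -(2 * (((n + 1 : ℕ) : ℤ) + 2)) by push_cast; ring] at h2
    qify at h1 h2
    push_cast at h1 h2 ⊢
    obtain ⟨ih1, ih2⟩ := ih
    have he := evenSum_add_two n
    have ho := oddSum_add_one n
    constructor <;> linarith

theorem value_formula_k_eq_two (L : ℤ → ℤ) (hL : IsGenLucas 2 L) (m : ℤ) (hm : 1 ≤ m) :
    (L (-(2 * m - 1)) : ℚ) =
      -∑ i ∈ Finset.Icc (0 : ℤ) (m - 1),
        ((psi (m - i - 1) (2 * i - 2) : ℚ) * (2 : ℚ) ^ (m - 3 * i + 1) +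
          (psi (m - i - 1) (2 * i - 1) : ℚ) * (2 : ℚ) ^ (m - 3 * i - 1)) ∧
    (L (-(2 * m)) : ℚ) =
      ∑ i ∈ Finset.Icc (0 : ℤ) (m - 1),
        ((psi (m - i - 1) (2 * i - 1) : ℚ) * (2 : ℚ) ^ (m - 3 * i) +
          (psi (m - i - 1) (2 * i) : ℚ) * (2 : ℚ) ^ (m - 3 * i - 2)) := by
  rcases eq_or_lt_of_le hm with rfl | hm
  · norm_num [hL.two_neg_one, hL.two_neg_two, psi, C]
  · obtain ⟨n, rfl⟩ : ∃ n : ℕ, m = n + 2 := ⟨(m - 2).toNat, by omega⟩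
    rw [sum_psi_odd, sum_psi_even]
    exact hL.two_neg_eq_sums n
end

section
/- Let k ≥ 4 be an even integer and let n be an integer with n ≥ k²-2k-1. Then L_{-n}^{(k)} > 0 if n is even, and L_{-n}^{(k)} < 0 if n is odd; in particular L_{-n}^{(k)} ≠ 0 for all n ≥ k²-2k-1. -/
/-- The two-term form of the recurrence, read in the direction of decreasing indices. -/
lemma IsGenLucas.two_term {k : ℕ} {L : ℤ → ℤ} (hL : IsGenLucas k L) (n : ℤ) :
    L (n - k - 1) = 2 * L (n - 1) - L n := by
  have h₁ := hL.1 n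
  have h₂ := hL.1 (n - 1)
  have h : ∀ f : ℕ → ℤ, ∑ i ∈ Finset.Icc 1 k, f i = ∑ i ∈ Finset.range k, f (i + 1) := fun f => by
    rw [Finset.range_eq_Ico, Finset.sum_Ico_add' f 0 k 1]
    rfl
  rw [h] at h₁ h₂
  have h₃ := Finset.sum_range_succ' (fun i : ℕ => L (n - 1 - i)) k
  rw [Finset.sum_range_succ, ← h₂] at h₃
  have h₄ : ∑ i ∈ Finset.range k, L (n - 1 - (i : ℤ)) = L n := by
    rw [h₁]
    refine Finset.sum_congr rfl fun i _ => ?_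
    push_cast
    congr 1
    ring
  rw [h₄, Nat.cast_zero, sub_zero, sub_right_comm n 1 (k : ℤ)] at h₃
  linarith

/-- `(-1) ^ m * L (-m)`, which is nonnegative when `k` is even. -/
def signedLucas (L : ℤ → ℤ) (m : ℕ) : ℤ := (-1) ^ m * L (-(m : ℤ))

lemma IsGenLucas.signedLucas_add {k : ℕ} {L : ℤ → ℤ} (hL : IsGenLucas k L) (hke : Even k)
    (m : ℕ) :
    signedLucas L (m + k + 1) = 2 * signedLucas L (m + 1) + signedLucas L m := by
  have h := hL.two_term (-(m : ℤ))
  simp only [signedLucas, pow_succ, pow_add, hke.neg_one_pow]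
  push_cast
  rw [show -((m : ℤ) + k + 1) = -(m : ℤ) - k - 1 by ring,
    show -((m : ℤ) + 1) = -(m : ℤ) - 1 by ring, h]
  ring

lemma IsGenLucas.signedLucas_eq_zero {k : ℕ} {L : ℤ → ℤ} (hL : IsGenLucas k L) {m : ℕ}
    (hm : 1 ≤ m) (hmk : m + 2 ≤ k) : signedLucas L m = 0 := by
  rw [signedLucas, hL.2.2.2 _ (by lia) (by lia), mul_zero]

lemma IsGenLucas.signedLucas_zero {k : ℕ} {L : ℤ → ℤ} (hL : IsGenLucas k L) :
    signedLucas L 0 = 2 := by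
  simp [signedLucas, hL.2.1]

lemma IsGenLucas.signedLucas_self {k : ℕ} {L : ℤ → ℤ} (hL : IsGenLucas k L)
    (hke : Even k) : signedLucas L k = 3 := by
  have h := hL.two_term 1
  rw [show (1 : ℤ) - k - 1 = -k by ring, sub_self, hL.2.1, hL.2.2.1] at h
  rw [signedLucas, h, hke.neg_one_pow]
  norm_num

lemma IsGenLucas.signedLucas_pred {k : ℕ} {L : ℤ → ℤ} (hL : IsGenLucas k L) (hk : 4 ≤ k)
    (hke : Even k) : signedLucas L (k - 1) = 1 := by
  have h := hL.1 1
  rw [← Finset.sum_subset (show {1, k} ⊆ Finset.Icc 1 k by grind)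
    fun i hi hi' => hL.2.2.2 _ (by grind) (by grind), Finset.sum_pair (by lia), hL.2.2.1,
    Nat.cast_one, sub_self, hL.2.1] at h
  have hodd : Odd (k - 1) := Nat.Even.sub_odd (by lia) hke odd_one
  rw [signedLucas, hodd.neg_one_pow, Nat.cast_sub (by lia), Nat.cast_one, neg_sub]
  linarith

lemma IsGenLucas.signedLucas_nonneg {k : ℕ} {L : ℤ → ℤ} (hL : IsGenLucas k L) (hk : 4 ≤ k)
    (hke : Even k) (m : ℕ) : 0 ≤ signedLucas L m := by
  induction m using Nat.strong_induction_on with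
  | _ m ih =>
    rcases lt_or_ge k m with h | h
    · obtain ⟨i, rfl⟩ : ∃ i, m = i + k + 1 := ⟨m - k - 1, by lia⟩
      rw [hL.signedLucas_add hke]
      linarith [ih (i + 1) (by lia), ih i (by lia)]
    · obtain rfl | ⟨h₁, h₂⟩ | rfl | rfl :
          m = 0 ∨ (1 ≤ m ∧ m + 2 ≤ k) ∨ m = k - 1 ∨ m = k := by lia
      · simp [hL.signedLucas_zero]
      · exact (hL.signedLucas_eq_zero h₁ h₂).ge
      · simp [hL.signedLucas_pred hk hke]
      · simp [hL.signedLucas_self hke]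

lemma IsGenLucas.signedLucas_pos {k : ℕ} {L : ℤ → ℤ} (hL : IsGenLucas k L) (hk : 4 ≤ k)
    (hke : Even k) (p s : ℕ) (hs : s ≤ p + 2) : 0 < signedLucas L (p * k + (k - 1) + s) := by
  induction p generalizing s with
  | zero =>
    obtain rfl | rfl | rfl : s = 0 ∨ s = 1 ∨ s = 2 := by lia
    · simp [hL.signedLucas_pred hk hke]
    · rw [show 0 * k + (k - 1) + 1 = k by lia, hL.signedLucas_self hke]
      norm_num
    · rw [show 0 * k + (k - 1) + 2 = 0 + k + 1 by lia, hL.signedLucas_add hke,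
        hL.signedLucas_zero]
      linarith [hL.signedLucas_nonneg hk hke (0 + 1)]
  | succ p ih =>
    obtain ⟨i, hi⟩ : ∃ i, p * k + (k - 1) + s = i + 1 := ⟨p * k + (k - 2) + s, by lia⟩
    rw [show (p + 1) * k + (k - 1) + s = i + k + 1 by rw [add_mul]; lia,
      hL.signedLucas_add hke]
    have h₀ := hL.signedLucas_nonneg hk hke i
    rcases hs.lt_or_eq with h | rfl
    · have := ih s (by lia)
      rw [hi] at this
      linarith
    · have := ih (p + 2) le_rfl
      rw [show p * k + (k - 1) + (p + 2) = i by lia] at this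
      linarith [hL.signedLucas_nonneg hk hke (i + 1)]

lemma IsGenLucas.signedLucas_pos_of_le {k : ℕ} {L : ℤ → ℤ} (hL : IsGenLucas k L) (hk : 4 ≤ k)
    (hke : Even k) {m : ℕ} (hm : (k - 2) * k ≤ m + 1) : 0 < signedLucas L m := by
  have hq : k - 2 ≤ (m + 1) / k := (Nat.le_div_iff_mul_le (by lia)).2 hm
  have hr := Nat.mod_lt (m + 1) (show k > 0 by lia)
  obtain ⟨p, hp⟩ : ∃ p, (m + 1) / k = p + 1 := ⟨(m + 1) / k - 1, by lia⟩
  have hdiv := Nat.div_add_mod (m + 1) k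
  rw [hp, mul_comm, add_mul] at hdiv
  have := hL.signedLucas_pos hk hke p ((m + 1) % k) (by lia)
  rwa [show p * k + (k - 1) + (m + 1) % k = m by lia] at this

theorem sign_pattern_even_k (k : ℕ) (hk : 4 ≤ k) (hke : Even k)
    (L : ℤ → ℤ) (hL : IsGenLucas k L) (n : ℤ) (hn : (k : ℤ) ^ 2 - 2 * k - 1 ≤ n) :
    (Even n → 0 < L (-n)) ∧ (Odd n → L (-n) < 0) ∧ L (-n) ≠ 0 := by
  have hk' : (4 : ℤ) ≤ k := by exact_mod_cast hk
  lift n to ℕ using by nlinarith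
  have h : 0 < signedLucas L n := hL.signedLucas_pos_of_le hk hke (by
    zify [show 2 ≤ k by lia]
    linarith)
  rw [signedLucas] at h
  refine ⟨fun hn => ?_, fun hn => ?_, fun h₀ => by simp [h₀] at h⟩
  · simpa [((Int.even_coe_nat n).1 hn).neg_one_pow] using h
  · simpa [((Int.odd_coe_nat n).1 hn).neg_one_pow] using h
end

section
/- Let k ≥ 3 be an odd integer and let n be an integer with n ≥ k²-2k-1 such that L_{-n}^{(k)} = 0. Then n ≥ 2^((k-1)/2). -/
/-- If `v` is the exponent of the prime `p` in `q.choose t`, then some `q - i` with `i < t` is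
divisible by `p ^ v`. -/
theorem mod_pow_factorization_choose_lt {p q t : ℕ} (hp : p.Prime) (ht : 0 < t) (htq : t ≤ q) :
    q % p ^ (q.choose t).factorization p < t := by
  have hfac := Nat.factorization_choose hp htq (Nat.lt_succ_self _)
  set v := (q.choose t).factorization p
  rcases Nat.eq_zero_or_pos v with hv | hv
  · simpa [hv, Nat.mod_one] using ht
  obtain ⟨j, hj, hvj⟩ : ∃ j ∈ (Finset.Ico 1 (Nat.log p q).succ).filter
      (fun i => p ^ i ≤ t % p ^ i + (q - t) % p ^ i), v ≤ j := by
    by_contra! h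
    have hsub := Finset.card_le_card (t := Finset.Ico 1 v) fun j hj =>
      Finset.mem_Ico.2 ⟨(Finset.mem_Ico.1 (Finset.mem_filter.1 hj).1).1, h j hj⟩
    rw [← hfac, Nat.card_Ico] at hsub
    omega
  have hcarry := (Finset.mem_filter.1 hj).2
  have hpos : 0 < p ^ j := pow_pos hp.pos j
  have hqj : q % p ^ j < t := by
    have h1 : q % p ^ j = (t % p ^ j + (q - t) % p ^ j) % p ^ j := by
      rw [← Nat.add_mod, Nat.add_sub_cancel' htq]
    have h2 := Nat.mod_lt t hpos
    have h3 := Nat.mod_lt (q - t) hpos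
    have h4 := Nat.mod_le t (p ^ j)
    have h5 : t % p ^ j + (q - t) % p ^ j - p ^ j < p ^ j := by omega
    rw [Nat.mod_eq_sub_mod hcarry, Nat.mod_eq_of_lt h5] at h1
    omega
  rw [← Nat.mod_mod_of_dvd q (pow_dvd_pow p hvj)]
  exact (Nat.mod_le _ _).trans_lt hqj

/-- A binomial coefficient whose computation carries out of the `v` lowest digits is divisible
by `p`. -/
theorem dvd_choose_of_mod_pow_lt {p n m v : ℕ} (hp : p.Prime) (h : n % p ^ v < m)
    (hm : m < p ^ v) : p ∣ n.choose m := by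
  rcases lt_or_ge n m with hnm | hmn
  · simp [Nat.choose_eq_zero_of_lt hnm]
  have hv : 1 ≤ v := by
    by_contra! hv
    obtain rfl : v = 0 := by omega
    simp at h hm
    omega
  have hpv : p ^ v ≤ n := by
    by_contra! hn
    rw [Nat.mod_eq_of_lt hn] at h
    omega
  have hmem : v ∈ (Finset.Ico 1 (Nat.log p n).succ).filter
      (fun i => p ^ i ≤ m % p ^ i + (n - m) % p ^ i) := by
    refine Finset.mem_filter.2 ⟨Finset.mem_Ico.2 ⟨hv,
      Nat.lt_succ_of_le (Nat.le_log_of_pow_le hp.one_lt hpv)⟩, ?_⟩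
    by_contra! hc
    have h1 : n % p ^ v = (m % p ^ v + (n - m) % p ^ v) % p ^ v := by
      rw [← Nat.add_mod, Nat.add_sub_cancel' hmn]
    rw [Nat.mod_eq_of_lt hc, Nat.mod_eq_of_lt hm] at h1
    exact h.not_ge (h1 ▸ Nat.le_add_right _ _)
  refine Nat.dvd_of_factorization_pos (p := p) ?_
  rw [Nat.factorization_choose hp hmn (Nat.lt_succ_self _)]
  exact (Finset.card_pos.2 ⟨v, hmem⟩).ne'

/-- Expansion of `y ^ ((k + 1) * q) = (2 * y - 1) ^ q`, where `y` is the shift of sequences. -/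
theorem shift_recurrence_expansion {R : Type*} [CommRing R] {k : ℕ} {H : ℕ → R}
    (hH : ∀ m, H (m + (k + 1)) = 2 * H (m + 1) - H m) (q s : ℕ) :
    H ((k + 1) * q + s) =
      ∑ j ∈ Finset.range (q + 1), (q.choose j : R) * (-1) ^ (q + j) * 2 ^ j * H (s + j) := by
  induction q generalizing s with
  | zero => simp
  | succ q ih =>
    rw [show (k + 1) * (q + 1) + s = ((k + 1) * q + s) + (k + 1) by ring, hH,
      show (k + 1) * q + s + 1 = (k + 1) * q + (s + 1) by ring, ih, ih,
      Finset.sum_range_succ' _ (q + 1)]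
    have hlast : ∑ j ∈ Finset.range (q + 1),
        (q.choose j : R) * (-1) ^ (q + j) * 2 ^ j * H (s + j) =
        ∑ j ∈ Finset.range (q + 1),
          (q.choose (j + 1) : R) * (-1) ^ (q + (j + 1)) * 2 ^ (j + 1) * H (s + (j + 1)) +
        (-1) ^ q * H s := by
      have h1 := Finset.sum_range_succ
        (fun j => (q.choose j : R) * (-1) ^ (q + j) * 2 ^ j * H (s + j)) (q + 1)
      rw [Finset.sum_range_succ'] at h1
      simpa using h1.symm
    rw [hlast, Finset.mul_sum, ← sub_sub, ← Finset.sum_sub_distrib, sub_eq_add_neg]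
    congr 1
    · refine Finset.sum_congr rfl fun j _ => ?_
      rw [Nat.choose_succ_succ, show s + 1 + j = s + (j + 1) by ring]
      push_cast
      ring
    · simp [pow_succ]

/-- The sequence with `k`-step sums satisfies a three-term recurrence. -/
theorem IsGenLucas.succ_eq {k : ℕ} {L : ℤ → ℤ} (hL : IsGenLucas k L) (n : ℤ) :
    L (n + 1) = 2 * L n - L (n - k) := by
  have hrange (m : ℤ) : L m = ∑ i ∈ Finset.range k, L (m - ((i + 1 : ℕ) : ℤ)) := by
    rw [hL.1 m, ← Finset.Ico_succ_right_eq_Icc, Finset.sum_Ico_eq_sum_range]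
    simp [add_comm]
  have h1 := Finset.sum_range_succ (fun i : ℕ => L (n - (i : ℤ))) k
  rw [Finset.sum_range_succ', ← hrange n] at h1
  have h2 : L (n + 1) = ∑ i ∈ Finset.range k, L (n - (i : ℤ)) := by
    rw [hrange]
    refine Finset.sum_congr rfl fun i _ => ?_
    congr 1
    push_cast
    ring
  simp only [Nat.cast_zero, sub_zero] at h1
  linarith

theorem IsGenLucas.neg_add_s15 {k : ℕ} {L : ℤ → ℤ} (hL : IsGenLucas k L) (m : ℕ) :
    L (-((m + (k + 1) : ℕ) : ℤ)) = 2 * L (-((m + 1 : ℕ) : ℤ)) - L (-(m : ℤ)) := by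
  have h := hL.succ_eq (-((m + 1 : ℕ) : ℤ))
  rw [show -((m + 1 : ℕ) : ℤ) + 1 = -(m : ℤ) by push_cast; ring,
    show -((m + 1 : ℕ) : ℤ) - k = -((m + (k + 1) : ℕ) : ℤ) by push_cast; ring] at h
  linarith

theorem IsGenLucas.neg_eq_zero {k : ℕ} {L : ℤ → ℤ} (hL : IsGenLucas k L) {m : ℕ}
    (h1 : 1 ≤ m) (h2 : m + 2 ≤ k) : L (-(m : ℤ)) = 0 :=
  hL.2.2.2 _ (by omega) (by omega)

theorem IsGenLucas.neg_pred {k : ℕ} {L : ℤ → ℤ} (hL : IsGenLucas (k + 1) L) (hk : 1 ≤ k) :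
    L (-(k : ℤ)) = -1 := by
  have h := hL.1 1
  obtain ⟨j, rfl⟩ : ∃ j, k = j + 1 := ⟨k - 1, by omega⟩
  rw [← Finset.Ico_succ_right_eq_Icc, Finset.sum_Ico_eq_sum_range] at h
  have hsum : ∑ i ∈ Finset.range j, L (1 - ((1 + (i + 1) : ℕ) : ℤ)) = 0 := by
    refine Finset.sum_eq_zero fun i hi => hL.2.2.2 _ ?_ ?_ <;>
    · have := Finset.mem_range.1 hi
      push_cast
      omega
  simp only [Order.succ_eq_add_one, Nat.add_sub_cancel] at h
  rw [Finset.sum_range_succ, Finset.sum_range_succ', hsum] at h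
  rw [show (1 : ℤ) - ((1 + (j + 1) : ℕ) : ℤ) = -((j + 1 : ℕ) : ℤ) by push_cast; ring] at h
  have h0 := hL.2.1
  have h1 := hL.2.2.1
  norm_num [h0, h1] at h
  rw [show -((j + 1 : ℕ) : ℤ) = -1 + -(j : ℤ) by push_cast; ring]
  linarith

theorem IsGenLucas.neg_order {k : ℕ} {L : ℤ → ℤ} (hL : IsGenLucas k L) : L (-(k : ℤ)) = 3 := by
  have h := hL.succ_eq 0
  rw [zero_add, zero_sub, hL.2.1, hL.2.2.1] at h
  linarith

theorem Finset.dvd_sum_sub_sum_of_subset {ι R : Type*} [DecidableEq ι] [CommRing R] {s t : Finset ι}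
    {f : ι → R} {d : R} (hst : s ⊆ t) (h : ∀ i ∈ t, i ∉ s → d ∣ f i) :
    d ∣ ∑ i ∈ t, f i - ∑ i ∈ s, f i := by
  rw [← Finset.sum_sdiff hst, add_sub_cancel_right]
  exact Finset.dvd_sum fun i hi => h i (Finset.mem_sdiff.1 hi).1 (Finset.mem_sdiff.1 hi).2

/-- The 2-adic congruence forced by a zero of the sequence at `-((k + 1) * q + s)`. -/
theorem IsGenLucas.two_pow_dvd_of_eq_zero {k : ℕ} {L : ℤ → ℤ} (hL : IsGenLucas k L) {q s t : ℕ}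
    (hs : 1 ≤ s) (ht : 1 ≤ t) (hst : s + t + 1 = k)
    (h0 : L (-(((k + 1) * q + s : ℕ) : ℤ)) = 0) :
    (2 : ℤ) ^ (k + 2) ∣ (q.choose t + 6 * q.choose (t + 1) + 8 * q.choose (t + 2) : ℤ) -
      2 ^ (k + 1) * ((q + 1).choose (t + k + 1) : ℤ) := by
  set H : ℕ → ℤ := fun m => L (-(m : ℤ)) with hHdef
  have hrec : ∀ m, H (m + (k + 1)) = 2 * H (m + 1) - H m := hL.neg_add_s15
  have hzero : ∀ m, 1 ≤ m → m + 2 ≤ k → H m = 0 := fun m h1 h2 => hL.neg_eq_zero h1 h2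
  have hH0 : H 0 = 2 := by simpa [hHdef] using hL.2.1
  have hHk : H k = 3 := hL.neg_order
  have hHk1 : H (s + t) = -1 := by
    subst hst
    exact hL.neg_pred (by omega)
  have hHk2 : H (k + 1) = -2 := by
    have := hrec 0
    rw [zero_add, zero_add, hH0, hzero 1 le_rfl (by omega)] at this
    linarith
  have hH2k : H (k + k) = 7 := by
    have := hrec (s + t)
    rw [hst, hHk, hHk1, show s + t + (k + 1) = k + k by omega] at this
    linarith
  have hH2k1 : H (s + t + k) = -2 := by
    have := hrec (s + t - 1)
    rw [hzero (s + t - 1) (by omega) (by omega), show s + t - 1 + 1 = s + t by omega, hHk1,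
      show s + t - 1 + (k + 1) = s + t + k by omega] at this
    linarith
  have hmid : ∀ m, k + 2 ≤ m → m + 2 ≤ k + k → H m = 0 := by
    intro m h1 h2
    have := hrec (m - (k + 1))
    rw [hzero (m - (k + 1) + 1) (by omega) (by omega),
      hzero (m - (k + 1)) (by omega) (by omega),
      show m - (k + 1) + (k + 1) = m by omega] at this
    linarith
  have hexp := shift_recurrence_expansion hrec q s
  rw [show H ((k + 1) * q + s) = 0 from h0] at hexp
  set f : ℕ → ℤ := fun j => (q.choose j : ℤ) * (-1) ^ (q + j) * 2 ^ j * H (s + j) with hf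
  have hsum : ∑ j ∈ Finset.range (q + t + k + 2), f j = 0 := by
    rw [hexp]
    symm
    refine Finset.sum_subset (Finset.range_subset_range.2 (by omega)) fun j _ hj => ?_
    simp [Nat.choose_eq_zero_of_lt (show q < j by simpa using hj)]
  have hdvd := Finset.dvd_sum_sub_sum_of_subset (f := f) (d := 2 ^ (t + k + 2))
    (s := {t, t + 1, t + 2, t + k, t + k + 1}) (t := Finset.range (q + t + k + 2))
    (by intro j; simp only [Finset.mem_insert, Finset.mem_singleton, Finset.mem_range]; omega)
    (by
      intro j _ hj
      simp only [Finset.mem_insert, Finset.mem_singleton, not_or] at hj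
      by_cases hbig : t + k + 2 ≤ j
      · exact ((pow_dvd_pow 2 hbig).mul_left _).mul_right _
      · have : H (s + j) = 0 := by
          rcases lt_or_ge j t with h | h
          · exact hzero _ (by omega) (by omega)
          · exact hmid _ (by omega) (by omega)
        simp [hf, this])
  rw [hsum, zero_sub, dvd_neg, Finset.sum_insert (by simp; omega), Finset.sum_insert (by simp; omega),
    Finset.sum_insert (by simp; omega), Finset.sum_insert (by simp), Finset.sum_singleton] at hdvd
  simp only [hf, show s + (t + 1) = k by omega, show s + (t + 2) = k + 1 by omega,
    show s + (t + k) = s + t + k by omega, show s + (t + k + 1) = k + k by omega,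
    hHk, hHk1, hHk2, hH2k, hH2k1] at hdvd
  have hfactor : (2 : ℤ) ^ t * 2 ^ (k + 2) ∣ 2 ^ t * ((-1) ^ (q + t) *
      ((-1) ^ (k + 1) * 2 ^ (k + 1) * (q.choose (t + k) + 7 * q.choose (t + k + 1)) -
        (q.choose t + 6 * q.choose (t + 1) + 8 * q.choose (t + 2)))) := by
    rw [← pow_add, ← add_assoc]
    refine hdvd.trans (dvd_of_eq ?_)
    ring
  have hunit : (2 : ℤ) ^ (k + 2) ∣
      ((-1) ^ (k + 1) * 2 ^ (k + 1) * (q.choose (t + k) + 7 * q.choose (t + k + 1)) -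
        (q.choose t + 6 * q.choose (t + 1) + 8 * q.choose (t + 2))) := by
    have h := (mul_dvd_mul_iff_left (by positivity)).1 hfactor
    rcases neg_one_pow_eq_or ℤ (q + t) with h1 | h1 <;> rw [h1] at h
    · simpa only [one_mul] using h
    · rwa [neg_one_mul, dvd_neg] at h
  rw [Nat.choose_succ_succ]
  push_cast
  rcases neg_one_pow_eq_or ℤ (k + 1) with h1 | h1 <;> rw [h1] at hunit
  · refine ((dvd_neg.2 hunit).add (Dvd.intro (3 * (q.choose (t + k + 1) : ℤ)) rfl)).trans
      (dvd_of_eq ?_)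
    ring
  · refine ((dvd_neg.2 hunit).sub (Dvd.intro
      ((q.choose (t + k) : ℤ) + 4 * (q.choose (t + k + 1) : ℤ)) rfl)).trans (dvd_of_eq ?_)
    ring

theorem IsGenLucas.neg_ne_zero_of_mod {k : ℕ} {L : ℤ → ℤ} (hL : IsGenLucas k L) (hk : 3 ≤ k)
    {q s : ℕ} (hs : s = 0 ∨ s + 1 = k ∨ s = k) : L (-(((k + 1) * q + s : ℕ) : ℤ)) ≠ 0 := by
  intro h0
  have hexp := shift_recurrence_expansion (H := fun m : ℕ => L (-(m : ℤ))) hL.neg_add_s15 q s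
  simp only [h0] at hexp
  rw [Finset.sum_range_succ'] at hexp
  simp only [Nat.choose_zero_right, Nat.cast_one, one_mul, add_zero, pow_zero, mul_one] at hexp
  rcases hs with rfl | rfl | rfl
  · have hdvd : (4 : ℤ) ∣ ∑ j ∈ Finset.range q, (q.choose (j + 1) : ℤ) * (-1) ^ (q + (j + 1)) *
        2 ^ (j + 1) * L (-((0 + (j + 1) : ℕ) : ℤ)) := by
      refine Finset.dvd_sum fun j _ => ?_
      rcases Nat.eq_zero_or_pos j with rfl | hj
      · rw [hL.neg_eq_zero (by omega) (by omega), mul_zero]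
        exact dvd_zero _
      · exact (((pow_dvd_pow 2 (show 2 ≤ j + 1 by omega)).mul_left _).mul_right _)
    have hL0 : L (-((0 : ℕ) : ℤ)) = 2 := by simpa using hL.2.1
    rw [hL0] at hexp
    rcases neg_one_pow_eq_or ℤ q with h1 | h1 <;> rw [h1] at hexp <;> omega
  all_goals
    have hdvd : (2 : ℤ) ∣ ∑ j ∈ Finset.range q, (q.choose (j + 1) : ℤ) * (-1) ^ (q + (j + 1)) *
        2 ^ (j + 1) * L (-((s + (j + 1) : ℕ) : ℤ)) :=
      Finset.dvd_sum fun j _ =>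
        (((dvd_pow_self 2 j.succ_ne_zero).mul_left _).mul_right _)
  · rw [hL.neg_pred (by omega)] at hexp
    rcases neg_one_pow_eq_or ℤ q with h1 | h1 <;> rw [h1] at hexp <;> omega
  · rw [hL.neg_order] at hexp
    rcases neg_one_pow_eq_or ℤ q with h1 | h1 <;> rw [h1] at hexp <;> omega

/-- The quadratic form in `q` and `t` for which `(t + 1) * (t + 2)` times
`q.choose t + 6 * q.choose (t + 1) + 8 * q.choose (t + 2)` is `q.choose t` times its value. -/
def chooseQuadratic (x t : ℤ) : ℤ :=
  8 * x ^ 2 - 10 * x * t + 3 * t ^ 2 + 4 * x - t + 2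

theorem mul_choose_combination {q t : ℕ} (htq : t ≤ q) :
    ((t : ℤ) + 1) * (t + 2) * (q.choose t + 6 * q.choose (t + 1) + 8 * q.choose (t + 2)) =
      q.choose t * chooseQuadratic q t := by
  have h1 : (q.choose (t + 1) : ℤ) * (t + 1) = q.choose t * (q - t) := by
    have := congrArg (Nat.cast : ℕ → ℤ) (Nat.choose_succ_right_eq q t)
    push_cast [Nat.cast_sub htq] at this
    exact this
  have h2 : (q.choose (t + 2) : ℤ) * (t + 2) = q.choose (t + 1) * (q - t - 1) := by
    rcases htq.eq_or_lt with rfl | hlt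
    · simp [Nat.choose_eq_zero_of_lt]
    have := congrArg (Nat.cast : ℕ → ℤ) (Nat.choose_succ_right_eq q (t + 1))
    push_cast [Nat.cast_sub (show t + 1 ≤ q from hlt)] at this
    linear_combination this
  unfold chooseQuadratic
  linear_combination (6 * (t + 2 : ℤ) + 8 * (q - t - 1)) * h1 + 8 * (t + 1 : ℤ) * h2

theorem chooseQuadratic_sub (x y t : ℤ) :
    chooseQuadratic x t - chooseQuadratic y t =
      (x - y) * (2 * (4 * (x - y) + 8 * y - 5 * t + 2)) := by
  unfold chooseQuadratic
  ring

theorem chooseQuadratic_le {q t : ℕ} (ht : 1 ≤ t) (htq : t ≤ q) :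
    chooseQuadratic q t ≤ 8 * (q : ℤ) ^ 2 := by
  unfold chooseQuadratic
  have h1 : (1 : ℤ) ≤ t := by exact_mod_cast ht
  have h2 : (t : ℤ) ≤ q := by exact_mod_cast htq
  nlinarith [mul_nonneg (sub_nonneg.2 h1) (sub_nonneg.2 h2),
    mul_nonneg (sub_nonneg.2 h2) (show (0 : ℤ) ≤ t by omega)]

theorem chooseQuadratic_pos {q t : ℕ} (htq : t ≤ q) : 0 < chooseQuadratic q t := by
  have hpos : (0 : ℤ) < q.choose t := by exact_mod_cast Nat.choose_pos htq
  refine pos_of_mul_pos_right (a := (q.choose t : ℤ)) ?_ hpos.le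
  rw [← mul_choose_combination htq]
  positivity

theorem abs_chooseQuadratic_le {i t : ℕ} (hit : i < t) :
    |chooseQuadratic i t| ≤ 3 * (t : ℤ) ^ 2 + 2 := by
  unfold chooseQuadratic
  have h1 : (i : ℤ) + 1 ≤ t := by exact_mod_cast hit
  have h2 : (0 : ℤ) ≤ i := by positivity
  rw [abs_le]
  constructor
  · nlinarith [sq_nonneg (8 * (i : ℤ) - 5 * t + 2)]
  · nlinarith [mul_nonneg h2 (sub_nonneg.2 h1)]

theorem chooseQuadratic_eq_zero {i t : ℕ} (hit : i < t) (h : chooseQuadratic i t = 0) :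
    t = 13 ∧ i = 8 ∨ t = 14 ∧ i = 8 ∨ t = 14 ∧ i = 9 ∨ t = 19 ∧ i = 13 := by
  have hsq : (8 * (i : ℤ) - 5 * t + 2) ^ 2 = ((t : ℤ) - 6) ^ 2 - 48 := by
    unfold chooseQuadratic at h
    linear_combination 8 * h
  have ht : t ≤ 30 := by
    by_contra! ht
    have ht' : (31 : ℤ) ≤ t := by exact_mod_cast ht
    have h1 : |8 * (i : ℤ) - 5 * t + 2| < t - 6 :=
      abs_lt_of_sq_lt_sq (by linarith) (by linarith)
    have h2 : (t : ℤ) - 6 - 1 < |8 * (i : ℤ) - 5 * t + 2| :=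
      lt_abs.2 (lt_abs.1 ((le_abs_self _).trans_lt (sq_lt_sq.1 (by nlinarith))))
    omega
  unfold chooseQuadratic at h
  interval_cases t <;> interval_cases i <;> simp_all

/-- A zero of the quadratic form at `y` makes its value at a number 2-adically close to `y`
divisible by few further powers of two. -/
theorem le_add_three_of_two_pow_dvd {i t K e : ℕ} (hit : i < t) (h : chooseQuadratic i t = 0)
    {m : ℤ} (he : 1 ≤ e) (hm : Odd m)
    (hdvd : (2 : ℤ) ^ K ∣ chooseQuadratic (i + 2 ^ e * m) t) : K ≤ e + 3 := by
  have hsub := chooseQuadratic_sub (i + 2 ^ e * m) i t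
  rw [h, sub_zero, add_sub_cancel_left] at hsub
  rw [hsub] at hdvd
  by_contra! hK
  have h16 : (2 : ℤ) ^ e * 16 ∣ 2 ^ e * (m * (2 * (4 * (2 ^ e * m) + 8 * i - 5 * t + 2))) := by
    rw [show (2 : ℤ) ^ e * 16 = 2 ^ (e + 4) by ring, ← mul_assoc]
    exact (pow_dvd_pow 2 hK).trans hdvd
  have h16' := (mul_dvd_mul_iff_left (by positivity)).1 h16
  have hcop : IsCoprime (16 : ℤ) m := by
    rw [show (16 : ℤ) = 2 ^ 4 by norm_num]
    exact (Int.isCoprime_two_left.2 hm).pow_left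
  have hlast := hcop.dvd_of_dvd_mul_left h16'
  obtain ⟨d, rfl⟩ : ∃ d, e = d + 1 := ⟨e - 1, by omega⟩
  rw [pow_succ] at hlast
  generalize (2 : ℤ) ^ d = z at hlast
  rw [show 4 * (z * 2 * m) = 8 * (z * m) by ring] at hlast
  generalize z * m = y at hlast
  rcases chooseQuadratic_eq_zero hit h with ⟨rfl, rfl⟩ | ⟨rfl, rfl⟩ | ⟨rfl, rfl⟩ | ⟨rfl, rfl⟩ <;>
    push_cast at hlast <;> omega

theorem two_pow_le_sq_of_two_pow_dvd {k q t : ℕ} (ht : 1 ≤ t) (htk : t + 2 ≤ k) (htq : t ≤ q)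
    (hdvd : (2 : ℤ) ^ (k + 2) ∣ (q.choose t + 6 * q.choose (t + 1) + 8 * q.choose (t + 2) : ℤ) -
      2 ^ (k + 1) * ((q + 1).choose (t + k + 1) : ℤ)) :
    2 ^ (k - 1) ≤ ((k + 1) * q) ^ 2 := by
  obtain ⟨k, rfl⟩ : ∃ j, k = j + 1 := ⟨k - 1, by omega⟩
  rw [Nat.add_sub_cancel]
  have hq : 1 ≤ q := ht.trans htq
  set v := (q.choose t).factorization 2
  set i := q % 2 ^ v
  have hit : i < t := mod_pow_factorization_choose_lt Nat.prime_two ht htq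
  have hQpos := chooseQuadratic_pos htq
  have hQle := chooseQuadratic_le ht htq
  have hdecomp := Nat.ordProj_mul_ordCompl_eq_self (q.choose t) 2
  set c := q.choose t / 2 ^ v
  have hcodd : IsCoprime (2 : ℤ) c := by
    have := Nat.coprime_ordCompl Nat.prime_two (Nat.choose_pos htq).ne'
    exact_mod_cast Nat.isCoprime_iff_coprime.2 this
  have hcomb := mul_choose_combination htq
  have heven : (2 : ℤ) ∣ ((t : ℤ) + 1) * (t + 2) := by
    have := (Int.even_mul_succ_self ((t : ℤ) + 1)).two_dvd
    rwa [add_assoc, one_add_one_eq_two] at this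
  -- each power of two dividing the combination gives one more dividing `2 ^ v * Q`
  have htransfer : ∀ K : ℕ, (2 : ℤ) ^ K ∣
      (q.choose t + 6 * q.choose (t + 1) + 8 * q.choose (t + 2) : ℤ) →
      (2 : ℤ) ^ (K + 1) ∣ 2 ^ v * chooseQuadratic q t := by
    intro K hK
    have h := mul_dvd_mul heven hK
    rw [hcomb, ← pow_succ', ← hdecomp] at h
    refine (hcodd.pow_left (m := K + 1)).dvd_of_dvd_mul_left (h.trans (dvd_of_eq ?_))
    push_cast
    ring
  rcases le_or_gt (2 ^ v) (t + (k + 1) + 1) with hsmall | hlarge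
  · have h1 : (2 : ℤ) ^ (k + 2) ∣
        (q.choose t + 6 * q.choose (t + 1) + 8 * q.choose (t + 2) : ℤ) :=
      (dvd_sub_left (Dvd.intro _ rfl)).1 ((pow_dvd_pow 2 (by omega)).trans hdvd)
    have h2 := Int.le_of_dvd (by positivity) (htransfer _ h1)
    have h3 : (2 : ℤ) ^ v ≤ 2 * (k + 1) := by
      have : 2 ^ v ≤ 2 * (k + 1) := by omega
      exact_mod_cast this
    have h4 : (2 : ℤ) ^ v * chooseQuadratic q t ≤ 2 * (k + 1) * (8 * q ^ 2) :=
      mul_le_mul h3 hQle hQpos.le (by positivity)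
    have h5 : (2 : ℤ) ^ k ≤ ((k + 1 + 1) * q) ^ 2 := by
      rw [pow_add, pow_add] at h2
      nlinarith [sq_nonneg ((k : ℤ) * q), sq_nonneg (q : ℤ)]
    exact_mod_cast h5
  have hlarge' : (2 : ℤ) ^ (k + 3) ∣
      (q.choose t + 6 * q.choose (t + 1) + 8 * q.choose (t + 2) : ℤ) := by
    have h1 : 2 ∣ (q + 1).choose (t + (k + 1) + 1) := by
      refine dvd_choose_of_mod_pow_lt (v := v) Nat.prime_two ?_ hlarge
      rw [← Nat.mod_add_mod]
      exact (Nat.mod_le _ _).trans_lt (by omega)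
    have h2 : (2 : ℤ) ^ (k + 3) ∣ 2 ^ (k + 1 + 1) * ((q + 1).choose (t + (k + 1) + 1) : ℤ) := by
      rw [show k + 3 = k + 1 + 1 + 1 from rfl, pow_succ _ (k + 1 + 1)]
      exact mul_dvd_mul_left _ (by exact_mod_cast h1)
    exact (dvd_sub_left h2).1 hdvd
  have hmain := htransfer _ hlarge'
  have hv1 : 1 ≤ v := by
    by_contra! h
    obtain h : v = 0 := by omega
    rw [h] at hlarge
    omega
  have hqi : 2 ^ v ∣ q - i := Nat.dvd_sub_mod q
  have hvq : 2 ^ v ≤ q := (Nat.le_of_dvd (by omega) hqi).trans (Nat.sub_le _ _)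
  have hqk : q ^ 2 ≤ ((k + 1 + 1) * q) ^ 2 :=
    Nat.pow_le_pow_left (Nat.le_mul_of_pos_left q (by omega)) 2
  by_cases hnd : (2 : ℤ) ^ (v + 1) ∣ chooseQuadratic q t
  · by_cases hzero : chooseQuadratic i t = 0
    · obtain ⟨e, m, hm, hem⟩ := Nat.exists_eq_two_pow_mul_odd (show q - i ≠ 0 by omega)
      have hqe : (q : ℤ) = i + 2 ^ e * (m : ℤ) := by
        have : q = i + 2 ^ e * m := by omega
        exact_mod_cast this
      have hve : v ≤ e := by
        rw [hem] at hqi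
        exact (Nat.pow_dvd_pow_iff_le_right (by norm_num)).1
          ((Nat.Coprime.pow_left v hm.coprime_two_left).dvd_of_dvd_mul_right hqi)
      have heq : 2 ^ e ≤ q :=
        (Nat.le_of_dvd (by omega) (Dvd.intro m hem.symm)).trans (Nat.sub_le _ _)
      have hK : k + 4 - v ≤ e + 3 := by
        refine le_add_three_of_two_pow_dvd hit hzero (hv1.trans hve)
          (m := m) (by exact_mod_cast hm) ?_
        rw [← hqe]
        rcases le_total (k + 4) v with h | h
        · simp [Nat.sub_eq_zero_of_le h]
        refine (mul_dvd_mul_iff_left (a := (2 : ℤ) ^ v) (by positivity)).1 ?_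
        rwa [← pow_add, Nat.add_sub_cancel' h]
      calc 2 ^ k ≤ 2 ^ (e * 2) := Nat.pow_le_pow_right (by norm_num) (by omega)
        _ = (2 ^ e) ^ 2 := pow_mul _ _ _
        _ ≤ q ^ 2 := Nat.pow_le_pow_left heq 2
        _ ≤ _ := hqk
    · have h1 : (2 : ℤ) ^ (v + 1) ∣ chooseQuadratic i t := by
        refine (dvd_sub_right hnd).1 ?_
        rw [chooseQuadratic_sub, ← mul_assoc, pow_succ]
        refine (mul_dvd_mul_right ?_ 2).mul_right _
        have : ((2 ^ v : ℕ) : ℤ) ∣ ((q - i : ℕ) : ℤ) := Int.natCast_dvd_natCast.2 hqi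
        rwa [Nat.cast_sub (by omega), Nat.cast_pow, Nat.cast_two] at this
      have h2 := Int.le_of_dvd (abs_pos.2 hzero) ((dvd_abs _ _).2 h1)
      have h3 := h2.trans (abs_chooseQuadratic_le hit)
      have h4 := Int.le_of_dvd (by positivity) hmain
      have h5 : (2 : ℤ) ^ v * chooseQuadratic q t ≤ 2 ^ v * (8 * q ^ 2) :=
        mul_le_mul_of_nonneg_left hQle (by positivity)
      have h6 : 3 * (t : ℤ) ^ 2 + 2 ≤ 3 * (k + 1) ^ 2 := by
        have : (t : ℤ) + 1 ≤ k := by exact_mod_cast (show t + 1 ≤ k by omega)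
        nlinarith
      have h7 : (2 : ℤ) ^ v * 2 * (q : ℤ) ^ 2 ≤ 3 * (k + 1) ^ 2 * q ^ 2 :=
        mul_le_mul_of_nonneg_right (by rw [← pow_succ]; exact h3.trans h6) (by positivity)
      have h8 : (2 : ℤ) ^ k ≤ ((k + 1 + 1) * q) ^ 2 := by
        rw [pow_add, pow_add] at h4
        nlinarith [sq_nonneg (q : ℤ), mul_nonneg (show (0 : ℤ) ≤ k by positivity) (sq_nonneg (q : ℤ))]
      exact_mod_cast h8
  · have hK : k + 4 ≤ v * 2 := by
      by_contra! h
      refine hnd ((mul_dvd_mul_iff_left (a := (2 : ℤ) ^ v) (by positivity)).1 ?_)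
      rw [← pow_add]
      exact (pow_dvd_pow 2 (by omega)).trans hmain
    calc 2 ^ k ≤ 2 ^ (v * 2) := Nat.pow_le_pow_right (by norm_num) (by omega)
      _ = (2 ^ v) ^ 2 := pow_mul _ _ _
      _ ≤ q ^ 2 := Nat.pow_le_pow_left hvq 2
      _ ≤ _ := hqk

theorem zero_lower_bound_odd_k (k : ℕ) (hk : 3 ≤ k) (hko : Odd k)
    (L : ℤ → ℤ) (hL : IsGenLucas k L) (n : ℤ) (hn : (k : ℤ) ^ 2 - 2 * k - 1 ≤ n)
    (hzero : L (-n) = 0) :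
    2 ^ ((k - 1) / 2) ≤ n := by
  have hk' : (3 : ℤ) ≤ k := by exact_mod_cast hk
  lift n to ℕ using by nlinarith
  obtain ⟨q, s, hs, rfl⟩ : ∃ q s, s < k + 1 ∧ n = (k + 1) * q + s :=
    ⟨n / (k + 1), n % (k + 1), Nat.mod_lt _ k.succ_pos, (Nat.div_add_mod _ _).symm⟩
  by_cases hs' : s = 0 ∨ s + 1 = k ∨ s = k
  · exact absurd hzero (hL.neg_ne_zero_of_mod hk hs')
  obtain ⟨t, hst⟩ : ∃ t, s + t + 1 = k := ⟨k - 1 - s, by omega⟩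
  have htq : t ≤ q := by
    by_contra! h
    have h1 : (q : ℤ) + 1 ≤ t := by exact_mod_cast h
    have h2 : (s : ℤ) + t + 1 = k := by exact_mod_cast hst
    have h3 : (1 : ℤ) ≤ s := by exact_mod_cast (show 1 ≤ s by omega)
    push_cast at hn
    nlinarith
  have hpow := two_pow_le_sq_of_two_pow_dvd (by omega) (by omega) htq
    (hL.two_pow_dvd_of_eq_zero (by omega) (by omega) hst hzero)
  have hsq : 2 ^ ((k - 1) / 2) ≤ (k + 1) * q := by
    refine (Nat.pow_le_pow_iff_left two_ne_zero).1 ?_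
    rw [← pow_mul]
    exact (Nat.pow_le_pow_right (by norm_num) (Nat.div_mul_le_self _ _)).trans hpow
  exact_mod_cast hsq.trans (Nat.le_add_right _ _)
end
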